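/- arXiv:1710.08943 — 2 statements merged into one kernel-verified Lean document; each statement's English description precedes it below -/
import Mathlib

section
/- Let n ≥ 2 and μ ∈ A_n. Then lev(μ) = 1 if and only if μ lies in the orbit of one of the following structures: A_3 ⊕ k^{n−2}; n_3 ⊕ k^{n−3} (this case occurring only when n ≥ 3); p^-; or ν^α for some α ∈ k. Moreover, the listed structures lie in pairwise distinct orbits (in particular ν^α and ν^β lie in distinct orbits for α ≠ β). -/
open scoped BigOperators

noncomputable section

/-- The space of `n`-dimensional (nonassociative) algebra structures on `kⁿ`:
bilinear maps `kⁿ × kⁿ → kⁿ`. -/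
abbrev AlgStr (k : Type*) [Field k] (n : ℕ) : Type _ :=
  (Fin n → k) →ₗ[k] (Fin n → k) →ₗ[k] (Fin n → k)

variable {k : Type*} [Field k]

/-- The algebra structure with prescribed structure constants `c`:
`μ(x, y) m = ∑ i, ∑ j, x i * y j * c i j m`. -/
def ofConst {n : ℕ} (c : Fin n → Fin n → Fin n → k) : AlgStr k n :=
  ∑ i, ∑ j,
    ((LinearMap.mul k k).compl₁₂ (LinearMap.proj i) (LinearMap.proj j)).compr₂
      (LinearMap.toSpanSingleton k (Fin n → k) (c i j))

/-- The structure constants of an algebra structure in the standard basis. -/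
def structConst {n : ℕ} (μ : AlgStr k n) : Fin n × Fin n × Fin n → k :=
  fun t => μ (Pi.single t.1 1) (Pi.single t.2.1 1) t.2.2

/-- A subset of `AlgStr k n` is Zariski closed if it is the common zero locus of a
family of polynomials in the structure constants. -/
def IsZariskiClosed {n : ℕ} (S : Set (AlgStr k n)) : Prop :=
  ∃ P : Set (MvPolynomial (Fin n × Fin n × Fin n) k),
    ∀ μ : AlgStr k n, μ ∈ S ↔ ∀ p ∈ P, MvPolynomial.eval (structConst μ) p = 0

/-- The action of `GL(V)` on algebra structures: `(g • μ)(x,y) = g (μ (g⁻¹ x) (g⁻¹ y))`. -/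
def transport {n : ℕ} (g : (Fin n → k) ≃ₗ[k] (Fin n → k)) (μ : AlgStr k n) :
    AlgStr k n :=
  ((μ.comp g.symm.toLinearMap).compl₂ g.symm.toLinearMap).compr₂ g.toLinearMap

/-- The `GL(V)`-orbit of an algebra structure; two structures represent isomorphic
algebras iff they lie in the same orbit. -/
def orbit {n : ℕ} (μ : AlgStr k n) : Set (AlgStr k n) :=
  {χ | ∃ g : (Fin n → k) ≃ₗ[k] (Fin n → k), transport g μ = χ}

/-- The Zariski closure of a set of algebra structures. -/
def zclosure {n : ℕ} (S : Set (AlgStr k n)) : Set (AlgStr k n) :=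
  {χ | ∀ T : Set (AlgStr k n), IsZariskiClosed T → S ⊆ T → χ ∈ T}

/-- `μ` degenerates to `χ` if `χ` lies in the Zariski closure of the orbit of `μ`. -/
def degenerates {n : ℕ} (μ χ : AlgStr k n) : Prop :=
  χ ∈ zclosure (orbit μ)

/-- A proper degeneration: additionally `χ` is not isomorphic to `μ`. -/
def properlyDegenerates {n : ℕ} (μ χ : AlgStr k n) : Prop :=
  degenerates μ χ ∧ χ ∉ orbit μ

/-- There is a chain of `m` proper degenerations starting at `μ`. -/
def hasChain {n : ℕ} (μ : AlgStr k n) (m : ℕ) : Prop :=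
  ∃ c : ℕ → AlgStr k n, c m = μ ∧ ∀ i < m, properlyDegenerates (c (i + 1)) (c i)

/-- The level of `μ` is `m`: there is a chain of `m` proper degenerations starting
at `μ` but no chain of `m+1`. -/
def levelIs {n : ℕ} (μ : AlgStr k n) (m : ℕ) : Prop :=
  hasChain μ m ∧ ¬ hasChain μ (m + 1)

/-- The subalgebra generated by a set `s`. -/
def subalgGen {n : ℕ} (μ : AlgStr k n) (s : Set (Fin n → k)) :
    Submodule k (Fin n → k) :=
  sInf {W | s ⊆ W ∧ ∀ x ∈ W, ∀ y ∈ W, μ x y ∈ W}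

/-- The generation type of `μ` is `m`: `m` is the maximal dimension of a
one-generated subalgebra. -/
def genType {n : ℕ} (μ : AlgStr k n) (m : ℕ) : Prop :=
  IsGreatest {d : ℕ | ∃ a : Fin n → k, Module.finrank k ↥(subalgGen μ {a}) = d} m

/-- A standard `1`-generated algebra: it admits a grading `A = ⊕_{i ≥ 1} A_i` with
`dim A_1 = 1`, `A_i A_j ⊆ A_{i+j}`, generated by `A_1` as an algebra. -/
def StandardOneGenerated {m : ℕ} (μ : AlgStr k m) : Prop :=
  ∃ A : ℕ → Submodule k (Fin m → k),
    A 0 = ⊥ ∧ DirectSum.IsInternal A ∧ Module.finrank k ↥(A 1) = 1 ∧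
    (∀ i j : ℕ, ∀ x ∈ A i, ∀ y ∈ A j, μ x y ∈ A (i + j)) ∧
    subalgGen μ ((A 1 : Submodule k (Fin m → k)) : Set (Fin m → k)) = ⊤

/-- Extension by zero of coordinates, `kᵐ → kⁿ`. -/
def inclMap (k : Type*) [Field k] {m n : ℕ} (h : m ≤ n) :
    (Fin m → k) →ₗ[k] (Fin n → k) where
  toFun x i := if hi : (i : ℕ) < m then x ⟨i, hi⟩ else 0
  map_add' x y := by funext i; by_cases hi : (i : ℕ) < m <;> simp [hi]
  map_smul' a x := by funext i; by_cases hi : (i : ℕ) < m <;> simp [hi]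

/-- The `n`-dimensional algebra `B ⊕ k^{n-m}` obtained from an `m`-dimensional
algebra `B` by adjoining a complement with all products zero. -/
def extendZero {m n : ℕ} (h : m ≤ n) (B : AlgStr k m) : AlgStr k n :=
  ((B.comp (LinearMap.funLeft k k (Fin.castLE h))).compl₂
      (LinearMap.funLeft k k (Fin.castLE h))).compr₂ (inclMap k h)

/-- The `i`-th standard basis vector (as a plain function, `0` if `i ≥ n`). -/
def unitVec {k : Type*} [Field k] (n i : ℕ) : Fin n → k :=
  fun j => if (j : ℕ) = i then 1 else 0

/-- Projection onto the coordinate `0` part. -/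
def proj0 (k : Type*) [Field k] (n : ℕ) : (Fin n → k) →ₗ[k] (Fin n → k) :=
  LinearMap.pi fun i => if (i : ℕ) = 0 then LinearMap.proj i else 0

/-- Projection onto the coordinates `≥ 1` part. -/
def projPos (k : Type*) [Field k] (n : ℕ) : (Fin n → k) →ₗ[k] (Fin n → k) :=
  LinearMap.pi fun i => if (i : ℕ) = 0 then 0 else LinearMap.proj i

/-- The Inönü–Wigner contraction of `μ` with respect to the `1`-dimensional
subalgebra spanned by the first basis vector (the remaining coordinates form the
square-zero ideal part). -/
def IWcontract0 {n : ℕ} (μ : AlgStr k n) : AlgStr k n :=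
  ((μ.comp (projPos k n)).compl₂ (proj0 k n)).compr₂ (projPos k n) +
    ((μ.comp (proj0 k n)).compl₂ (projPos k n)).compr₂ (projPos k n) +
    (μ.comp (proj0 k n)).compl₂ (proj0 k n)

/-- The annihilator of an algebra structure. -/
def annihilator {n : ℕ} (μ : AlgStr k n) : Submodule k (Fin n → k) where
  carrier := {a | ∀ b, μ a b = 0 ∧ μ b a = 0}
  add_mem' := by
    intro a b ha hb
    intro c
    constructor
    · rw [map_add, LinearMap.add_apply, (ha c).1, (hb c).1, add_zero]
    · rw [map_add, (ha c).2, (hb c).2, add_zero]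
  zero_mem' := by
    intro b
    constructor
    · rw [map_zero, LinearMap.zero_apply]
    · rw [map_zero]
  smul_mem' := by
    intro t a ha b
    constructor
    · rw [map_smul, LinearMap.smul_apply, (ha b).1, smul_zero]
    · rw [map_smul, (ha b).2, smul_zero]

/-- `μ` has a square-zero (two-sided) ideal of codimension `1`. -/
def hasSqZeroIdealCodim1 {n : ℕ} (μ : AlgStr k n) : Prop :=
  ∃ I : Submodule k (Fin n → k), Module.finrank k ↥I = n - 1 ∧
    (∀ x ∈ I, ∀ y : Fin n → k, μ x y ∈ I ∧ μ y x ∈ I) ∧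
    ∀ x ∈ I, ∀ y ∈ I, μ x y = 0

/-- `a` (viewed as the sequence of parts `a 0 ≥ a 1 ≥ …`) is a partition of `N`. -/
def IsPartitionOf (a : ℕ → ℕ) (N : ℕ) : Prop :=
  (∀ i j : ℕ, i ≤ j → a j ≤ a i) ∧
    ∃ l : ℕ, (∀ i, l ≤ i → a i = 0) ∧ ∑ i ∈ Finset.range l, a i = N

/-- The dominance order on partitions: `a ⪰ b`. -/
def Dominates (a b : ℕ → ℕ) : Prop :=
  ∀ m : ℕ, ∑ i ∈ Finset.range m, b i ≤ ∑ i ∈ Finset.range m, a i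

/-- `a` is the Jordan type of the matrix `M` at the eigenvalue `lam`:
`a` is a partition of the generalized eigenspace dimension, and the parts of `a`
are the sizes of the Jordan blocks of `M` with eigenvalue `lam`, expressed via
the ranks of powers of `M - lam • 1`. -/
def IsJordanTypeAt {N : ℕ} (M : Matrix (Fin N) (Fin N) k) (lam : k) (a : ℕ → ℕ) :
    Prop :=
  IsPartitionOf a (N - ((M - lam • (1 : Matrix (Fin N) (Fin N) k)) ^ N).rank) ∧
    ∀ p : ℕ, ((M - lam • (1 : Matrix (Fin N) (Fin N) k)) ^ p).rank =
      N - ∑ i ∈ Finset.range N, min (a i) p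

/-- The full specter of `M` is `{(lam i, a i)}`: the `lam i` are pairwise distinct,
each `a i` is the (nonempty) Jordan type of `M` at `lam i`, and every eigenvalue
of `M` occurs among the `lam i`. -/
def IsFullSpecter {N : ℕ} (M : Matrix (Fin N) (Fin N) k) {l : ℕ}
    (lam : Fin l → k) (a : Fin l → ℕ → ℕ) : Prop :=
  Function.Injective lam ∧
    (∀ i, IsJordanTypeAt M (lam i) (a i) ∧ a i 0 ≠ 0) ∧
    ∀ c : k, (∃ v : Fin N → k, v ≠ 0 ∧ M.mulVec v = c • v) → ∃ i, lam i = c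

/-- There is a chain of `len` strict dominance steps of partitions of `N`
starting (on top) at `a`. -/
def partChain (a : ℕ → ℕ) (N len : ℕ) : Prop :=
  ∃ c : ℕ → ℕ → ℕ, (∀ i ≤ len, IsPartitionOf (c i) N) ∧ c len = a ∧
    ∀ i < len, Dominates (c (i + 1)) (c i) ∧ c (i + 1) ≠ c i

/-- The structure `T_α^M ∈ A_{m+1}`. -/
def Tstr {m : ℕ} (α : k) (M : Matrix (Fin m) (Fin m) k) : AlgStr k (m + 1) :=
  ofConst fun i j mm =>
    if hi : i = 0 then
      if hj : j = 0 then (if mm = 0 then α else 0)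
      else if hmm : mm = 0 then 0 else M (mm.pred hmm) (j.pred hj)
    else if hj : j = 0 then
      if hmm : mm = 0 then 0 else (if i = mm then α else 0) - M (mm.pred hmm) (i.pred hi)
    else 0

/-- The trivial singular extension `k^{n-2} ⋊_{(L₁,R₁,L₂,R₂)} χ` of the
`2`-dimensional algebra `χ` given by the coefficients `c11, c12, c21, d12, d21, d22`
(with `χ(e₁,e₁) = c11·e₁ + e₂`, `χ(e₁,e₂) = c12·e₁ + d12·e₂`,
`χ(e₂,e₁) = c21·e₁ + d21·e₂`, `χ(e₂,e₂) = d22·e₂`). -/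
def sdExt {m : ℕ} (c11 c12 c21 d12 d21 d22 : k)
    (L1 R1 L2 R2 : Matrix (Fin m) (Fin m) k) : AlgStr k (m + 2) :=
  ofConst fun i j mm =>
    if hi0 : (i : ℕ) = 0 then
      if hj0 : (j : ℕ) = 0 then
        if (mm : ℕ) = 0 then c11 else if (mm : ℕ) = 1 then 1 else 0
      else if hj1 : (j : ℕ) = 1 then
        if (mm : ℕ) = 0 then c12 else if (mm : ℕ) = 1 then d12 else 0
      else if hmm : (mm : ℕ) < 2 then 0
      else L1 ⟨(mm : ℕ) - 2, by have := mm.isLt; omega⟩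
             ⟨(j : ℕ) - 2, by have := j.isLt; omega⟩
    else if hi1 : (i : ℕ) = 1 then
      if hj0 : (j : ℕ) = 0 then
        if (mm : ℕ) = 0 then c21 else if (mm : ℕ) = 1 then d21 else 0
      else if hj1 : (j : ℕ) = 1 then
        if (mm : ℕ) = 1 then d22 else 0
      else if hmm : (mm : ℕ) < 2 then 0
      else L2 ⟨(mm : ℕ) - 2, by have := mm.isLt; omega⟩
             ⟨(j : ℕ) - 2, by have := j.isLt; omega⟩
    else
      if hj0 : (j : ℕ) = 0 then
        if hmm : (mm : ℕ) < 2 then 0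
        else R1 ⟨(mm : ℕ) - 2, by have := mm.isLt; omega⟩
               ⟨(i : ℕ) - 2, by have := i.isLt; omega⟩
      else if hj1 : (j : ℕ) = 1 then
        if hmm : (mm : ℕ) < 2 then 0
        else R2 ⟨(mm : ℕ) - 2, by have := mm.isLt; omega⟩
               ⟨(i : ℕ) - 2, by have := i.isLt; omega⟩
      else 0

/-! Concrete algebra structures, given by multiplication tables on the standard
basis `e₁, …, eₙ` (0-indexed as `0, …, n-1`); all unspecified products are zero. -/

/-- `A₃ ⊕ k^{n-2}`: `e₁e₁ = e₂`. -/
def A3str (n : ℕ) : AlgStr k n :=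
  ofConst fun i j m => if (i : ℕ) = 0 ∧ (j : ℕ) = 0 ∧ (m : ℕ) = 1 then 1 else 0

/-- `n₃ ⊕ k^{n-3}`: `e₁e₂ = e₃`, `e₂e₁ = -e₃`. -/
def n3str (n : ℕ) : AlgStr k n :=
  ofConst fun i j m =>
    if (i : ℕ) = 0 ∧ (j : ℕ) = 1 ∧ (m : ℕ) = 2 then 1
    else if (i : ℕ) = 1 ∧ (j : ℕ) = 0 ∧ (m : ℕ) = 2 then -1
    else 0

/-- `p⁻`: `e₁eᵢ = eᵢ`, `eᵢe₁ = -eᵢ` for `i ≥ 2`. -/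
def pminusStr (n : ℕ) : AlgStr k n :=
  ofConst fun i j m =>
    if (i : ℕ) = 0 ∧ 1 ≤ (j : ℕ) ∧ m = j then 1
    else if 1 ≤ (i : ℕ) ∧ (j : ℕ) = 0 ∧ m = i then -1
    else 0

/-- `ν^α`: `e₁e₁ = e₁`, `e₁eᵢ = α eᵢ`, `eᵢe₁ = (1-α) eᵢ` for `i ≥ 2`. -/
def nuStr (n : ℕ) (α : k) : AlgStr k n :=
  ofConst fun i j m =>
    if (i : ℕ) = 0 then
      if (j : ℕ) = 0 then (if (m : ℕ) = 0 then 1 else 0)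
      else (if m = j then α else 0)
    else if (j : ℕ) = 0 then (if m = i then 1 - α else 0)
    else 0

/-- `k^{n-2} ⋊ E₄`: `e₁e₁ = e₁`, `e₁e₂ = e₁ + e₂`, `e₂e₂ = e₂`,
`e₁eᵢ = eᵢ`, `eᵢe₂ = eᵢ` for `i ≥ 3`.  (For `n = 2` this is `E₄`.) -/
def kE4str (n : ℕ) : AlgStr k n :=
  ofConst fun i j m =>
    if (i : ℕ) = 0 ∧ (j : ℕ) = 0 then (if (m : ℕ) = 0 then 1 else 0)
    else if (i : ℕ) = 0 ∧ (j : ℕ) = 1 then (if (m : ℕ) = 0 ∨ (m : ℕ) = 1 then 1 else 0)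
    else if (i : ℕ) = 1 ∧ (j : ℕ) = 1 then (if (m : ℕ) = 1 then 1 else 0)
    else if (i : ℕ) = 0 ∧ 2 ≤ (j : ℕ) then (if m = j then 1 else 0)
    else if 2 ≤ (i : ℕ) ∧ (j : ℕ) = 1 then (if m = i then 1 else 0)
    else 0

/-- `T₀^{2,(α,β)}`: `e₁e₂ = αe₂ + e₃`, `e₂e₁ = -αe₂ - e₃`,
`e₁eᵢ = βeᵢ`, `eᵢe₁ = -βeᵢ` for `i ≥ 3`. -/
def T02str (n : ℕ) (α β : k) : AlgStr k n :=
  ofConst fun i j m =>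
    if (i : ℕ) = 0 ∧ (j : ℕ) = 1 then
      (if (m : ℕ) = 1 then α else if (m : ℕ) = 2 then 1 else 0)
    else if (i : ℕ) = 1 ∧ (j : ℕ) = 0 then
      (if (m : ℕ) = 1 then -α else if (m : ℕ) = 2 then -1 else 0)
    else if (i : ℕ) = 0 ∧ 2 ≤ (j : ℕ) then (if m = j then β else 0)
    else if 2 ≤ (i : ℕ) ∧ (j : ℕ) = 0 then (if m = i then -β else 0)
    else 0

/-- `T₁^{2,(α,β)}`: `e₁e₁ = e₁`, `e₁e₂ = αe₂ + e₃`, `e₂e₁ = (1-α)e₂ - e₃`,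
`e₁eᵢ = βeᵢ`, `eᵢe₁ = (1-β)eᵢ` for `i ≥ 3`. -/
def T12str (n : ℕ) (α β : k) : AlgStr k n :=
  ofConst fun i j m =>
    if (i : ℕ) = 0 ∧ (j : ℕ) = 0 then (if (m : ℕ) = 0 then 1 else 0)
    else if (i : ℕ) = 0 ∧ (j : ℕ) = 1 then
      (if (m : ℕ) = 1 then α else if (m : ℕ) = 2 then 1 else 0)
    else if (i : ℕ) = 1 ∧ (j : ℕ) = 0 then
      (if (m : ℕ) = 1 then 1 - α else if (m : ℕ) = 2 then -1 else 0)
    else if (i : ℕ) = 0 ∧ 2 ≤ (j : ℕ) then (if m = j then β else 0)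
    else if 2 ≤ (i : ℕ) ∧ (j : ℕ) = 0 then (if m = i then 1 - β else 0)
    else 0

/-- `T₀³`: `e₁e₂ = e₃`, `e₂e₁ = -e₃`, `e₁e₃ = e₄`, `e₃e₁ = -e₄`. -/
def T03str (n : ℕ) : AlgStr k n :=
  ofConst fun i j m =>
    if (i : ℕ) = 0 ∧ (j : ℕ) = 1 ∧ (m : ℕ) = 2 then 1
    else if (i : ℕ) = 1 ∧ (j : ℕ) = 0 ∧ (m : ℕ) = 2 then -1
    else if (i : ℕ) = 0 ∧ (j : ℕ) = 2 ∧ (m : ℕ) = 3 then 1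
    else if (i : ℕ) = 2 ∧ (j : ℕ) = 0 ∧ (m : ℕ) = 3 then -1
    else 0

/-- `T₀^{2,2}`: `e₁e₂ = e₃`, `e₂e₁ = -e₃`, `e₁e₄ = e₅`, `e₄e₁ = -e₅`. -/
def T022str (n : ℕ) : AlgStr k n :=
  ofConst fun i j m =>
    if (i : ℕ) = 0 ∧ (j : ℕ) = 1 ∧ (m : ℕ) = 2 then 1
    else if (i : ℕ) = 1 ∧ (j : ℕ) = 0 ∧ (m : ℕ) = 2 then -1
    else if (i : ℕ) = 0 ∧ (j : ℕ) = 3 ∧ (m : ℕ) = 4 then 1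
    else if (i : ℕ) = 3 ∧ (j : ℕ) = 0 ∧ (m : ℕ) = 4 then -1
    else 0

/-- `η_l ⊕ k^{n-2l-1}`: `e_{2i-1}e_{2i} = e_{2l+1}`, `e_{2i}e_{2i-1} = -e_{2l+1}`
for `1 ≤ i ≤ l`. -/
def etaStr (n l : ℕ) : AlgStr k n :=
  ofConst fun i j m =>
    if (i : ℕ) % 2 = 0 ∧ (j : ℕ) = (i : ℕ) + 1 ∧ (i : ℕ) < 2 * l ∧ (m : ℕ) = 2 * l then 1
    else if (j : ℕ) % 2 = 0 ∧ (i : ℕ) = (j : ℕ) + 1 ∧ (j : ℕ) < 2 * l ∧ (m : ℕ) = 2 * l then -1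
    else 0

/-- `F^{α,β} ⊕ k^{n-3}`: `e₁e₁ = e₃`, `e₁e₂ = αe₃`, `e₂e₁ = βe₃`. -/
def FabStr (n : ℕ) (α β : k) : AlgStr k n :=
  ofConst fun i j m =>
    if (i : ℕ) = 0 ∧ (j : ℕ) = 0 ∧ (m : ℕ) = 2 then 1
    else if (i : ℕ) = 0 ∧ (j : ℕ) = 1 ∧ (m : ℕ) = 2 then α
    else if (i : ℕ) = 1 ∧ (j : ℕ) = 0 ∧ (m : ℕ) = 2 then β
    else 0

/-- `k^{n-2} ⋊ A₃`: `e₁e₁ = e₂`, `e₁eᵢ = eᵢ`, `eᵢe₁ = -eᵢ` for `i ≥ 3`. -/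
def kA3str (n : ℕ) : AlgStr k n :=
  ofConst fun i j m =>
    if (i : ℕ) = 0 ∧ (j : ℕ) = 0 ∧ (m : ℕ) = 1 then 1
    else if (i : ℕ) = 0 ∧ 2 ≤ (j : ℕ) then (if m = j then 1 else 0)
    else if 2 ≤ (i : ℕ) ∧ (j : ℕ) = 0 then (if m = i then -1 else 0)
    else 0

/-- `k² ⋊_{α,β} A₃ ⊕ k^{n-4}`: `e₁e₁ = e₂`, `e₁e₃ = αe₄`, `e₃e₁ = βe₄`. -/
def k2A3str (n : ℕ) (α β : k) : AlgStr k n :=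
  ofConst fun i j m =>
    if (i : ℕ) = 0 ∧ (j : ℕ) = 0 ∧ (m : ℕ) = 1 then 1
    else if (i : ℕ) = 0 ∧ (j : ℕ) = 2 ∧ (m : ℕ) = 3 then α
    else if (i : ℕ) = 2 ∧ (j : ℕ) = 0 ∧ (m : ℕ) = 3 then β
    else 0

/-- `k^{n-2} ⋊_α A₁^α`: `e₁e₁ = e₁ + e₂`, `e₁eᵢ = αeᵢ`, `eᵢe₁ = (1-α)eᵢ` for `i ≥ 2`. -/
def kA1str (n : ℕ) (α : k) : AlgStr k n :=
  ofConst fun i j m =>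
    if (i : ℕ) = 0 ∧ (j : ℕ) = 0 then (if (m : ℕ) = 0 ∨ (m : ℕ) = 1 then 1 else 0)
    else if (i : ℕ) = 0 then (if m = j then α else 0)
    else if (j : ℕ) = 0 then (if m = i then 1 - α else 0)
    else 0

/-- `k^{n-2} ⋊₁ A₂`: `e₁e₁ = e₂`, `e₁eᵢ = eᵢ`, `eᵢe₁ = -eᵢ` for `i ≥ 2`. -/
def kA2str (n : ℕ) : AlgStr k n :=
  ofConst fun i j m =>
    if (i : ℕ) = 0 ∧ (j : ℕ) = 0 then (if (m : ℕ) = 1 then 1 else 0)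
    else if (i : ℕ) = 0 then (if m = j then 1 else 0)
    else if (j : ℕ) = 0 then (if m = i then -1 else 0)
    else 0

/-- `k^{n-2} ⋊₀ᵗ B₂^α`: `e₁eᵢ = αeᵢ`, `eᵢe₁ = (1-α)eᵢ` for `i ≥ 2`. -/
def ktB2str (n : ℕ) (α : k) : AlgStr k n :=
  ofConst fun i j m =>
    if (i : ℕ) = 0 ∧ 1 ≤ (j : ℕ) then (if m = j then α else 0)
    else if 1 ≤ (i : ℕ) ∧ (j : ℕ) = 0 then (if m = i then 1 - α else 0)
    else 0

/-- `k^{n-2} ⋊₀ᵗ D₂^{α,β}`: `e₁e₁ = e₁`, `e₁eᵢ = αeᵢ`, `eᵢe₁ = βeᵢ` for `i ≥ 2`. -/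
def ktD2str (n : ℕ) (α β : k) : AlgStr k n :=
  ofConst fun i j m =>
    if (i : ℕ) = 0 ∧ (j : ℕ) = 0 then (if (m : ℕ) = 0 then 1 else 0)
    else if (i : ℕ) = 0 then (if m = j then α else 0)
    else if (j : ℕ) = 0 then (if m = i then β else 0)
    else 0


section OrbitsAndStructureConstants

variable {n : ℕ}

lemma algStr_ext {μ χ : AlgStr k n}
    (h : ∀ i j m, μ (Pi.single i 1) (Pi.single j 1) m = χ (Pi.single i 1) (Pi.single j 1) m) :
    μ = χ := by
  refine (Pi.basisFun k (Fin n)).ext fun i => (Pi.basisFun k (Fin n)).ext fun j => ?_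
  funext m
  simpa using h i j m

lemma ofConst_single (c : Fin n → Fin n → Fin n → k) (i j m : Fin n) :
    ofConst c (Pi.single i 1) (Pi.single j 1) m = c i j m := by
  simp only [ofConst, LinearMap.sum_apply, Finset.sum_apply]
  rw [Finset.sum_eq_single i, Finset.sum_eq_single j] <;> simp +contextual [Pi.single_apply]

lemma transport_apply (g : (Fin n → k) ≃ₗ[k] (Fin n → k)) (μ : AlgStr k n) (x y : Fin n → k) :
    transport g μ x y = g (μ (g.symm x) (g.symm y)) := rfl

lemma mem_orbit_self (μ : AlgStr k n) : μ ∈ orbit μ :=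
  ⟨LinearEquiv.refl k _, rfl⟩

lemma mem_orbit_symm {μ χ : AlgStr k n} (h : χ ∈ orbit μ) : μ ∈ orbit χ := by
  obtain ⟨g, rfl⟩ := h
  refine ⟨g.symm, ?_⟩
  refine LinearMap.ext fun x => LinearMap.ext fun y => ?_
  simp [transport_apply]

lemma mem_orbit_trans {μ χ ψ : AlgStr k n} (h : χ ∈ orbit μ) (h' : ψ ∈ orbit χ) :
    ψ ∈ orbit μ := by
  obtain ⟨g, rfl⟩ := h
  obtain ⟨g', rfl⟩ := h'
  exact ⟨g.trans g', rfl⟩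

lemma orbit_zero : orbit (0 : AlgStr k n) = {0} := by
  ext χ
  constructor
  · rintro ⟨g, rfl⟩
    refine LinearMap.ext fun x => LinearMap.ext fun y => ?_
    simp [transport_apply]
  · rintro rfl
    exact mem_orbit_self 0

lemma transport_basis_single (b : Module.Basis (Fin n) k (Fin n → k)) (μ : AlgStr k n)
    (i j m : Fin n) :
    transport b.equivFun μ (Pi.single i 1) (Pi.single j 1) m = b.repr (μ (b i) (b j)) m := by
  simp [transport_apply]

lemma mem_orbit_of_basis (b : Module.Basis (Fin n) k (Fin n → k)) {μ χ : AlgStr k n}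
    (h : ∀ i j m, b.repr (μ (b i) (b j)) m = χ (Pi.single i 1) (Pi.single j 1) m) :
    μ ∈ orbit χ :=
  mem_orbit_symm ⟨b.equivFun, algStr_ext fun i j m => by rw [transport_basis_single, h]⟩

/-- A linearly independent family extends to a basis indexed by `Fin n`. -/
lemma exists_basis_extending {r : ℕ} (hr : r ≤ n) {v : Fin r → Fin n → k}
    (hv : LinearIndependent k v) :
    ∃ b : Module.Basis (Fin n) k (Fin n → k), ∀ i, b (Fin.castLE hr i) = v i := by
  classical
  let B := Module.Basis.sumExtend hv
  have : Fintype (Module.Basis.sumExtendIndex hv) := by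
    have : Finite (Fin r ⊕ Module.Basis.sumExtendIndex hv) :=
      Module.Finite.finite_basis B
    have : Finite (Module.Basis.sumExtendIndex hv) := Finite.sum_right (Fin r)
    exact Fintype.ofFinite _
  have hcard : Fintype.card (Module.Basis.sumExtendIndex hv) = n - r := by
    have h := Module.finrank_eq_card_basis B
    rw [Module.finrank_fin_fun, Fintype.card_sum, Fintype.card_fin] at h
    omega
  let e : Fin r ⊕ Module.Basis.sumExtendIndex hv ≃ Fin n :=
    ((Equiv.sumCongr (Equiv.refl _) (Fintype.equivFinOfCardEq hcard)).trans finSumFinEquiv).trans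
      (finCongr (by omega))
  refine ⟨B.reindex e, fun i => ?_⟩
  have he : e.symm (Fin.castLE hr i) = Sum.inl i := by
    rw [Equiv.symm_apply_eq]
    ext
    simp [e]
  rw [Module.Basis.reindex_apply, he]
  simp only [B, Module.Basis.sumExtend, Module.Basis.reindex_apply, Module.Basis.extend_apply_self]
  rfl

/-- A linearly independent family `v` extends to a basis whose remaining vectors are values of a
given endomorphism congruent to the identity modulo the span of `v`. -/
lemma exists_basis_extending_map {r : ℕ} (hr : r ≤ n) {v : Fin r → Fin n → k}
    (hv : LinearIndependent k v) (φ : (Fin n → k) → Fin n → k)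
    (hφ : ∀ x, φ x - x ∈ Submodule.span k (Set.range v)) :
    ∃ b : Module.Basis (Fin n) k (Fin n → k), (∀ i, b (Fin.castLE hr i) = v i) ∧
      ∀ i : Fin n, r ≤ i → ∃ y, b i = φ y := by
  obtain ⟨b, hb⟩ := exists_basis_extending hr hv
  let w : Fin n → Fin n → k := fun i => if (i : ℕ) < r then b i else φ (b i)
  have hspan : Submodule.span k (Set.range v) ≤ Submodule.span k (Set.range w) := by
    rw [Submodule.span_le]
    rintro _ ⟨i, rfl⟩
    refine Submodule.subset_span ⟨Fin.castLE hr i, ?_⟩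
    simp [w, hb]
  have htop : ⊤ ≤ Submodule.span k (Set.range w) := by
    rw [← b.span_eq, Submodule.span_le]
    rintro _ ⟨i, rfl⟩
    have hwi : w i ∈ Submodule.span k (Set.range w) := Submodule.subset_span ⟨i, rfl⟩
    by_cases hi : (i : ℕ) < r
    · simpa [w, hi] using hwi
    · have h := sub_mem hwi (hspan (hφ (b i)))
      simpa [w, hi] using h
  refine ⟨basisOfTopLeSpanOfCardEqFinrank w htop (by simp), fun i => ?_, fun i hi => ⟨b i, ?_⟩⟩
  · rw [coe_basisOfTopLeSpanOfCardEqFinrank]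
    simp [w, hb]
  · rw [coe_basisOfTopLeSpanOfCardEqFinrank]
    simp [w, not_lt.mpr hi]

end OrbitsAndStructureConstants

section ZariskiTopology

variable {n : ℕ}

/-- A function on `AlgStr k n` that is polynomial in the structure constants. -/
def IsStructPoly (F : AlgStr k n → k) : Prop :=
  ∃ p : MvPolynomial (Fin n × Fin n × Fin n) k, ∀ μ, F μ = MvPolynomial.eval (structConst μ) p

lemma IsStructPoly.add {F G : AlgStr k n → k} (hF : IsStructPoly F) (hG : IsStructPoly G) :
    IsStructPoly fun μ => F μ + G μ := by
  obtain ⟨p, hp⟩ := hF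
  obtain ⟨q, hq⟩ := hG
  exact ⟨p + q, fun μ => by simp [hp, hq]⟩

lemma IsStructPoly.sub {F G : AlgStr k n → k} (hF : IsStructPoly F) (hG : IsStructPoly G) :
    IsStructPoly fun μ => F μ - G μ := by
  obtain ⟨p, hp⟩ := hF
  obtain ⟨q, hq⟩ := hG
  exact ⟨p - q, fun μ => by simp [hp, hq]⟩

lemma IsStructPoly.mul {F G : AlgStr k n → k} (hF : IsStructPoly F) (hG : IsStructPoly G) :
    IsStructPoly fun μ => F μ * G μ := by
  obtain ⟨p, hp⟩ := hF
  obtain ⟨q, hq⟩ := hG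
  exact ⟨p * q, fun μ => by simp [hp, hq]⟩

lemma IsStructPoly.sum {ι : Type*} (s : Finset ι) {F : ι → AlgStr k n → k}
    (hF : ∀ i, IsStructPoly (F i)) : IsStructPoly fun μ => ∑ i ∈ s, F i μ := by
  choose p hp using hF
  exact ⟨∑ i ∈ s, p i, fun μ => by simp [hp]⟩

lemma isStructPoly_linear (φ : AlgStr k n →ₗ[k] k) : IsStructPoly fun μ => φ μ := by
  refine ⟨∑ t : Fin n × Fin n × Fin n, MvPolynomial.C (φ (ofConst fun i j m =>
    if (i, j, m) = t then 1 else 0)) * MvPolynomial.X t, fun μ => ?_⟩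
  have h : μ = ∑ t : Fin n × Fin n × Fin n, structConst μ t •
      (ofConst fun i j m => if (i, j, m) = t then 1 else 0) := by
    refine algStr_ext fun i j m => ?_
    simp [LinearMap.sum_apply, Finset.sum_apply, ofConst_single, structConst]
  conv_lhs => rw [h]
  simp [mul_comm]

lemma isStructPoly_apply (x y : Fin n → k) (m : Fin n) : IsStructPoly fun μ => μ x y m :=
  isStructPoly_linear
    ((LinearMap.proj m).comp ((LinearMap.applyₗ y).comp (LinearMap.applyₗ x)))

lemma isStructPoly_apply_apply (x y z : Fin n → k) (m : Fin n) :
    IsStructPoly fun μ => μ x (μ y z) m := by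
  have h : (fun μ : AlgStr k n => μ x (μ y z) m) =
      fun μ => ∑ j, μ y z j * μ x (Pi.single j 1) m := by
    funext μ
    conv_lhs => rw [pi_eq_sum_univ' (μ y z)]
    simp [map_sum, Finset.sum_apply]
  rw [h]
  exact .sum _ fun j => (isStructPoly_apply y z j).mul (isStructPoly_apply x _ m)

lemma isStructPoly_apply_apply_left (x y z : Fin n → k) (m : Fin n) :
    IsStructPoly fun μ => μ (μ y z) x m := by
  have h : (fun μ : AlgStr k n => μ (μ y z) x m) =
      fun μ => ∑ j, μ y z j * μ (Pi.single j 1) x m := by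
    funext μ
    conv_lhs => rw [pi_eq_sum_univ' (μ y z)]
    simp [map_sum, Finset.sum_apply, LinearMap.sum_apply]
  rw [h]
  exact .sum _ fun j => (isStructPoly_apply y z j).mul (isStructPoly_apply _ x m)

lemma isZariskiClosed_setOf {ι : Type*} {F : ι → AlgStr k n → k} (hF : ∀ i, IsStructPoly (F i)) :
    IsZariskiClosed {μ | ∀ i, F i μ = 0} := by
  choose p hp using hF
  refine ⟨Set.range p, fun μ => ?_⟩
  simp [hp]

lemma IsZariskiClosed.inter {S T : Set (AlgStr k n)} (hS : IsZariskiClosed S)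
    (hT : IsZariskiClosed T) : IsZariskiClosed (S ∩ T) := by
  obtain ⟨P, hP⟩ := hS
  obtain ⟨Q, hQ⟩ := hT
  refine ⟨P ∪ Q, fun μ => ?_⟩
  simp only [Set.mem_inter_iff, hP, hQ, Set.mem_union]
  exact ⟨fun h p hp => hp.elim (h.1 p) (h.2 p), fun h => ⟨fun p hp => h p (.inl hp),
    fun p hp => h p (.inr hp)⟩⟩

lemma isZariskiClosed_submodule (W : Submodule k (AlgStr k n)) :
    IsZariskiClosed (W : Set (AlgStr k n)) := by
  convert isZariskiClosed_setOf
    (F := fun (φ : W.dualAnnihilator) (μ : AlgStr k n) => (φ : Module.Dual k (AlgStr k n)) μ)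
    (fun φ => isStructPoly_linear _) using 1
  ext μ
  simp only [SetLike.mem_coe]
  rw [← Subspace.forall_mem_dualAnnihilator_apply_eq_zero_iff W μ]
  simp

lemma degenerates_zero_iff {χ : AlgStr k n} : degenerates 0 χ ↔ χ = 0 := by
  constructor
  · intro h
    have := h _ (isZariskiClosed_submodule (⊥ : Submodule k (AlgStr k n)))
      (by rw [orbit_zero]; simp)
    simpa using this
  · rintro rfl
    exact fun T _ hT => hT (mem_orbit_self 0)

/-- The degeneration obtained by rescaling the vectors of a basis by powers of a parameter:
structure constants of positive weight disappear in the limit. -/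
lemma degenerates_of_weights [Infinite k] (μ : AlgStr k n)
    (b : Module.Basis (Fin n) k (Fin n → k)) (w : Fin n → ℕ)
    (hw : ∀ i j m, w i + w j < w m → b.repr (μ (b i) (b j)) m = 0) :
    degenerates μ (ofConst fun i j m =>
      if w i + w j = w m then b.repr (μ (b i) (b j)) m else 0) := by
  rintro T ⟨P, hP⟩ hT
  rw [hP]
  intro p hp
  let q : Fin n × Fin n × Fin n → Polynomial k := fun t =>
    Polynomial.C (b.repr (μ (b t.1) (b t.2.1)) t.2.2) *
      Polynomial.X ^ (w t.1 + w t.2.1 - w t.2.2)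
  have heval : ∀ s : k, Polynomial.eval s (MvPolynomial.aeval q p) =
      MvPolynomial.eval (fun t => Polynomial.eval s (q t)) p := by
    intro s
    rw [← Polynomial.coe_evalRingHom, MvPolynomial.aeval_def, MvPolynomial.hom_eval₂]
    rw [MvPolynomial.eval, MvPolynomial.eval₂Hom]
    congr 1
    ext a
    simp
  have hne : ∀ s : k, s ≠ 0 → Polynomial.eval s (MvPolynomial.aeval q p) = 0 := by
    intro s hs
    let b' := b.isUnitSMul (w := fun i => s ^ w i) fun i => (pow_ne_zero _ hs).isUnit
    have hmem := (hP _).1 (hT ⟨b'.equivFun, rfl⟩) p hp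
    rw [heval, ← hmem]
    congr 2
    funext ⟨i, j, m⟩
    have hrepr : ∀ x l, b'.repr x l = (s ^ w l)⁻¹ * b.repr x l := by
      intro x l
      simp [b', Module.Basis.repr_isUnitSMul, Units.smul_def]
    have hb' : ∀ l, b' l = s ^ w l • b l := fun l => Module.Basis.isUnitSMul_apply _ _
    simp only [structConst, transport_basis_single, hrepr, hb', q]
    simp only [map_smul, LinearMap.smul_apply, Finsupp.smul_apply, smul_eq_mul,
      Polynomial.eval_mul, Polynomial.eval_C, Polynomial.eval_pow, Polynomial.eval_X]
    rcases lt_or_ge (w i + w j) (w m) with h | h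
    · simp [hw i j m h]
    · have h2 : s ^ (w i + w j) = s ^ (w i + w j - w m) * s ^ w m := by
        rw [← pow_add, Nat.sub_add_cancel h]
      have h3 : s ^ w m ≠ 0 := pow_ne_zero _ hs
      rw [pow_add] at h2
      field_simp
      linear_combination -(b.repr (μ (b i) (b j)) m) * h2
  have hzero : MvPolynomial.aeval q p = 0 := by
    refine Polynomial.eq_zero_of_infinite_isRoot _ ?_
    refine (Set.finite_singleton (0 : k)).infinite_compl.mono fun s hs => hne s ?_
    simpa using hs
  have h0 := heval 0
  rw [hzero, Polynomial.eval_zero] at h0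
  refine Eq.trans ?_ h0.symm
  congr 2
  funext ⟨i, j, m⟩
  simp only [structConst, ofConst_single, q, Polynomial.eval_mul, Polynomial.eval_C,
    Polynomial.eval_pow, Polynomial.eval_X]
  rcases lt_trichotomy (w i + w j) (w m) with h | h | h
  · simp [hw i j m h]
  · simp [h]
  · rw [if_neg h.ne', zero_pow (by omega), mul_zero]

lemma degenerates_to_zero [Infinite k] (μ : AlgStr k n) : degenerates μ 0 := by
  have h := degenerates_of_weights μ (Pi.basisFun k (Fin n)) (fun _ => 1) (by simp)
  convert h
  exact algStr_ext fun i j m => by simp [ofConst_single]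

end ZariskiTopology

section LevelOne

variable {n : ℕ}

/-- A nonzero structure is of level one as soon as its orbit lies in a Zariski closed set
all of whose nonzero members belong to the orbit. -/
lemma levelIs_one_of_closed [Infinite k] {β : AlgStr k n} (S : Set (AlgStr k n))
    (hS : IsZariskiClosed S) (hβS : orbit β ⊆ S) (hSβ : ∀ χ ∈ S, χ ≠ 0 → χ ∈ orbit β)
    (hβ : β ≠ 0) {μ : AlgStr k n} (hμ : μ ∈ orbit β) : levelIs μ 1 := by
  have hμ0 : μ ≠ 0 := by
    rintro rfl
    have := mem_orbit_symm hμ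
    rw [orbit_zero] at this
    exact hβ this
  constructor
  · refine ⟨fun i => if i = 0 then 0 else μ, rfl, fun i hi => ?_⟩
    obtain rfl : i = 0 := by omega
    refine ⟨degenerates_to_zero μ, fun h => hμ0 ?_⟩
    have := mem_orbit_symm h
    simp only [if_true, orbit_zero] at this
    simpa using this
  · rintro ⟨c, rfl, hc⟩
    obtain ⟨h1, h1'⟩ := hc 1 (by omega)
    obtain ⟨h0, h0'⟩ := hc 0 (by omega)
    have hc1 : c 1 ∈ S := h1 S hS fun χ hχ => hβS (mem_orbit_trans hμ hχ)
    have hc1' : c 1 = 0 := by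
      by_contra hne
      exact h1' (mem_orbit_trans (mem_orbit_symm hμ) (hSβ _ hc1 hne))
    simp only [zero_add, hc1'] at h0 h0'
    rw [degenerates_zero_iff] at h0
    exact h0' (by rw [h0]; exact mem_orbit_self 0)

lemma mem_orbit_of_levelIs_one [Infinite k] {μ χ : AlgStr k n} (hμ : levelIs μ 1)
    (h : degenerates μ χ) (hχ : χ ≠ 0) : μ ∈ orbit χ := by
  by_contra hne
  refine hμ.2 ⟨fun i => if i = 0 then 0 else if i = 1 then χ else μ, rfl, fun i hi => ?_⟩
  interval_cases i
  · refine ⟨degenerates_to_zero χ, fun h0 => hχ ?_⟩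
    have := mem_orbit_symm h0
    simp only [if_true, orbit_zero] at this
    simpa using this
  · exact ⟨h, fun h' => hne (mem_orbit_symm h')⟩

lemma ne_zero_of_levelIs_one {μ : AlgStr k n} (hμ : levelIs μ 1) : μ ≠ 0 := by
  rintro rfl
  obtain ⟨c, hc, h⟩ := hμ.1
  obtain ⟨h0, h0'⟩ := h 0 (by omega)
  rw [zero_add, hc] at h0 h0'
  rw [degenerates_zero_iff] at h0
  exact h0' (by rw [h0]; exact mem_orbit_self 0)

end LevelOne

section LinearForms

variable {n : ℕ}

/-- The structures `(x, y) ↦ a f(x) y + b f(y) x`, linearly parametrized by the form `f`. -/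
def formStr (n : ℕ) (a b : k) : Module.Dual k (Fin n → k) →ₗ[k] AlgStr k n where
  toFun f := LinearMap.mk₂ k (fun x y => (a * f x) • y + (b * f y) • x)
    (fun x x' y => by simp only [map_add]; module)
    (fun c x y => by simp only [map_smul, smul_eq_mul]; module)
    (fun x y y' => by simp only [map_add]; module)
    (fun c x y => by simp only [map_smul, smul_eq_mul]; module)
  map_add' f g := by
    refine LinearMap.ext fun x => LinearMap.ext fun y => ?_
    simp only [LinearMap.mk₂_apply, LinearMap.add_apply]
    module
  map_smul' c f := by
    refine LinearMap.ext fun x => LinearMap.ext fun y => ?_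
    simp only [LinearMap.mk₂_apply, LinearMap.smul_apply, RingHom.id_apply, smul_eq_mul]
    module

lemma formStr_apply (a b : k) (f : Module.Dual k (Fin n → k)) (x y : Fin n → k) :
    formStr n a b f x y = (a * f x) • y + (b * f y) • x := rfl

lemma transport_formStr (a b : k) (f : Module.Dual k (Fin n → k))
    (g : (Fin n → k) ≃ₗ[k] (Fin n → k)) :
    transport g (formStr n a b f) = formStr n a b (f.comp g.symm.toLinearMap) := by
  refine LinearMap.ext fun x => LinearMap.ext fun y => ?_
  simp [transport_apply, formStr_apply]

lemma formStr_mem_orbit_proj (a b : k) {f : Module.Dual k (Fin n → k)} (hf : f ≠ 0) (i₀ : Fin n)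
    (hi₀ : (i₀ : ℕ) = 0) : formStr n a b f ∈ orbit (formStr n a b (LinearMap.proj i₀)) := by
  obtain ⟨u, hu⟩ : ∃ u, f u = 1 := LinearMap.surjective hf 1
  have hu0 : u ≠ 0 := by rintro rfl; simp at hu
  obtain ⟨B, hB, hB'⟩ := exists_basis_extending_map (r := 1) (v := ![u]) (by have := i₀.2; omega)
    (LinearIndependent.of_subsingleton 0 hu0) (fun x => x - f x • u)
    (fun x => by simpa using Submodule.smul_mem _ _ (Submodule.mem_span_singleton_self u))
  have hB0 : B i₀ = u := (congrArg B (Fin.ext hi₀)).trans (hB 0)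
  have hfB : ∀ i, f (B i) = if i = i₀ then 1 else 0 := by
    intro i
    split_ifs with h
    · rw [h, hB0, hu]
    · obtain ⟨y, hy⟩ := hB' i (by rw [Fin.ext_iff] at h; omega)
      simp [hy, hu]
  refine mem_orbit_of_basis B fun i j m => ?_
  simp only [formStr_apply, hfB, map_add, map_smul, Module.Basis.repr_self, LinearMap.proj_apply,
    Finsupp.add_apply, Finsupp.smul_apply, Pi.add_apply, Pi.smul_apply, Finsupp.single_apply,
    Pi.single_apply, eq_comm]

lemma formStr_mem_orbit (a b : k) {f g : Module.Dual k (Fin n → k)} (hf : f ≠ 0) (hg : g ≠ 0)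
    (hn : 0 < n) : formStr n a b f ∈ orbit (formStr n a b g) :=
  mem_orbit_trans (mem_orbit_symm (formStr_mem_orbit_proj a b hg ⟨0, hn⟩ rfl))
    (formStr_mem_orbit_proj a b hf ⟨0, hn⟩ rfl)

lemma exists_formStr_of_mem_orbit {a b : k} {f : Module.Dual k (Fin n → k)} {μ : AlgStr k n}
    (h : μ ∈ orbit (formStr n a b f)) : ∃ f', μ = formStr n a b f' := by
  obtain ⟨g, rfl⟩ := h
  exact ⟨_, transport_formStr a b f g⟩

lemma levelIs_one_formStr [Infinite k] (hn : 0 < n) {a b : k} {f : Module.Dual k (Fin n → k)}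
    (hβ : formStr n a b f ≠ 0) {μ : AlgStr k n} (hμ : μ ∈ orbit (formStr n a b f)) :
    levelIs μ 1 := by
  refine levelIs_one_of_closed _ (isZariskiClosed_submodule (LinearMap.range (formStr n a b)))
    ?_ ?_ hβ hμ
  · intro χ hχ
    obtain ⟨f', rfl⟩ := exists_formStr_of_mem_orbit hχ
    exact ⟨f', rfl⟩
  · rintro _ ⟨f', rfl⟩ hne
    refine formStr_mem_orbit a b ?_ ?_ hn
    · rintro rfl; simp at hne
    · rintro rfl; simp at hβ

lemma nuStr_eq (hn : 0 < n) (α : k) :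
    nuStr n α = formStr n α (1 - α) (LinearMap.proj ⟨0, hn⟩) := by
  refine algStr_ext fun i j m => ?_
  simp only [nuStr, ofConst_single, formStr_apply, LinearMap.proj_apply, Pi.add_apply,
    Pi.smul_apply, Pi.single_apply, smul_eq_mul, Fin.ext_iff]
  split_ifs <;> first | omega | simp

lemma pminusStr_eq (hn : 0 < n) :
    pminusStr (k := k) n = formStr n 1 (-1) (LinearMap.proj ⟨0, hn⟩) := by
  refine algStr_ext fun i j m => ?_
  simp only [pminusStr, ofConst_single, formStr_apply, LinearMap.proj_apply, Pi.add_apply,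
    Pi.smul_apply, Pi.single_apply, smul_eq_mul, Fin.ext_iff]
  split_ifs <;> first | omega | simp

lemma formStr_mem_orbit_pminus_or_nu (hn : 0 < n) {a b : k} (hab : a ≠ 0 ∨ b ≠ 0)
    {f : Module.Dual k (Fin n → k)} (hf : f ≠ 0) :
    formStr n a b f ∈ orbit (pminusStr n) ∨ ∃ α : k, formStr n a b f ∈ orbit (nuStr n α) := by
  have hproj : (LinearMap.proj ⟨0, hn⟩ : Module.Dual k (Fin n → k)) ≠ 0 := fun h => by
    simpa using LinearMap.congr_fun h (Pi.single ⟨0, hn⟩ 1)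
  by_cases hs : a + b = 0
  · left
    have ha : a ≠ 0 := by
      rintro rfl
      simp_all
    obtain rfl : b = -a := by linear_combination hs
    rw [pminusStr_eq hn]
    have h : formStr n a (-a) f = formStr n 1 (-1) (a • f) := by
      refine LinearMap.ext fun x => LinearMap.ext fun y => ?_
      simp [formStr_apply, smul_smul]
    rw [h]
    exact formStr_mem_orbit _ _ (smul_ne_zero ha hf) hproj hn
  · right
    refine ⟨a / (a + b), ?_⟩
    rw [nuStr_eq hn]
    have h : formStr n a b f = formStr n (a / (a + b)) (1 - a / (a + b)) ((a + b) • f) := by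
      refine LinearMap.ext fun x => LinearMap.ext fun y => ?_
      simp only [formStr_apply, LinearMap.smul_apply, smul_eq_mul]
      congr 2 <;> field_simp
      ring
    rw [h]
    exact formStr_mem_orbit _ _ (smul_ne_zero hs hf) hproj hn

end LinearForms

section ClosedOrbits

variable {n : ℕ}

lemma A3str_apply (hn : 2 ≤ n) (x y : Fin n → k) :
    A3str n x y = (x ⟨0, by omega⟩ * y ⟨0, by omega⟩) • Pi.single ⟨1, by omega⟩ 1 := by
  let χ : AlgStr k n := LinearMap.mk₂ k
    (fun x y => (x ⟨0, by omega⟩ * y ⟨0, by omega⟩) • (Pi.single ⟨1, by omega⟩ 1 : Fin n → k))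
    (fun x x' y => by simp only [Pi.add_apply]; module)
    (fun c x y => by simp only [Pi.smul_apply, smul_eq_mul]; module)
    (fun x y y' => by simp only [Pi.add_apply]; module)
    (fun c x y => by simp only [Pi.smul_apply, smul_eq_mul]; module)
  have h : A3str n = χ := by
    refine algStr_ext fun i j m => ?_
    simp only [A3str, ofConst_single, χ, LinearMap.mk₂_apply, Pi.smul_apply, Pi.single_apply,
      smul_eq_mul, Fin.ext_iff]
    split_ifs <;> first | omega | simp
  rw [h]
  rfl

lemma n3str_apply (hn : 3 ≤ n) (x y : Fin n → k) :
    n3str n x y = (x ⟨0, by omega⟩ * y ⟨1, by omega⟩ - x ⟨1, by omega⟩ * y ⟨0, by omega⟩) •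
      Pi.single ⟨2, by omega⟩ 1 := by
  let χ : AlgStr k n := LinearMap.mk₂ k
    (fun x y => (x ⟨0, by omega⟩ * y ⟨1, by omega⟩ - x ⟨1, by omega⟩ * y ⟨0, by omega⟩) •
      (Pi.single ⟨2, by omega⟩ 1 : Fin n → k))
    (fun x x' y => by simp only [Pi.add_apply]; module)
    (fun c x y => by simp only [Pi.smul_apply, smul_eq_mul]; module)
    (fun x y y' => by simp only [Pi.add_apply]; module)
    (fun c x y => by simp only [Pi.smul_apply, smul_eq_mul]; module)
  have h : n3str n = χ := by
    refine algStr_ext fun i j m => ?_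
    simp only [n3str, ofConst_single, χ, LinearMap.mk₂_apply, Pi.smul_apply, Pi.single_apply,
      smul_eq_mul, Fin.ext_iff]
    split_ifs <;> first | omega | simp
  rw [h]
  rfl

/-- Defining equations of the closure of the orbit of `A₃ ⊕ k^{n-2}`. -/
def A3closure (k : Type*) [Field k] (n : ℕ) : Set (AlgStr k n) :=
  {μ | ∀ t : ((Fin n → k) × (Fin n → k) × (Fin n → k) × (Fin n → k)) × Fin n × Fin n,
      μ t.1.1 t.1.2.1 t.2.1 * μ t.1.2.2.1 t.1.2.2.2 t.2.2 -
        μ t.1.1 t.1.2.2.1 t.2.2 * μ t.1.2.1 t.1.2.2.2 t.2.1 = 0} ∩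
  {μ | ∀ t : ((Fin n → k) × (Fin n → k) × (Fin n → k)) × Fin n,
      μ (μ t.1.2.1 t.1.2.2) t.1.1 t.2 = 0}

lemma orbit_A3str_subset (hn : 2 ≤ n) : orbit (A3str n) ⊆ A3closure k n := by
  rintro _ ⟨g, rfl⟩
  constructor
  · rintro ⟨⟨x, y, z, w⟩, m, m'⟩
    simp only [transport_apply, A3str_apply hn, map_smul, Pi.smul_apply, smul_eq_mul]
    ring
  · rintro ⟨⟨x, y, z⟩, m⟩
    simp [transport_apply, A3str_apply hn]

lemma mem_orbit_A3str (hn : 2 ≤ n) {χ : AlgStr k n} (h : χ ∈ A3closure k n) (hχ : χ ≠ 0) :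
    χ ∈ orbit (A3str n) := by
  have hsq : ∀ x y z w m m', χ x y m * χ z w m' = χ x z m' * χ y w m := fun x y z w m m' =>
    sub_eq_zero.mp (h.1 ⟨⟨x, y, z, w⟩, m, m'⟩)
  have hnil : ∀ x y z, χ (χ y z) x = 0 := fun x y z => funext fun m => h.2 ⟨⟨x, y, z⟩, m⟩
  obtain ⟨u, l, hs⟩ : ∃ u l, χ u u l ≠ 0 := by
    by_contra! H
    refine hχ (LinearMap.ext fun p => LinearMap.ext fun q => funext fun l => ?_)
    have := hsq p q p q l l
    rw [H p l, zero_mul] at this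
    simpa using this
  let f : Module.Dual k (Fin n → k) := (χ u u l)⁻¹ • (LinearMap.proj l).comp (χ.flip u)
  have hf : ∀ x, f x = (χ u u l)⁻¹ * χ x u l := fun x => rfl
  set v := χ u u with hv
  have hχf : ∀ x y, χ x y = (f x * f y) • v := by
    intro x y
    funext m
    have h1 := hsq x y u u m l
    have h2 := hsq y u u u m l
    rw [← hv] at h1 h2
    simp only [hf, Pi.smul_apply, smul_eq_mul]
    field_simp
    linear_combination (v l) * h1 + χ x u l * h2
  have hfu : f u = 1 := by rw [hf, ← hv, inv_mul_cancel₀ hs]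
  have hfv : f v = 0 := by rw [hf, hv, hnil]; simp
  have hv0 : v ≠ 0 := fun h0 => hs (by simp [h0])
  have hli : LinearIndependent k ![u, v] := by
    rw [LinearIndependent.pair_iff]
    intro s t hst
    have hs' : s = 0 := by simpa [hfu, hfv] using congrArg f hst
    subst hs'
    simpa [hv0] using hst
  obtain ⟨B, hB, hB'⟩ := exists_basis_extending_map hn hli (fun x => x - f x • u)
    (fun x => by
      have h0 : u ∈ Submodule.span k (Set.range ![u, v]) := Submodule.subset_span ⟨0, rfl⟩
      convert Submodule.smul_mem _ (-f x) h0 using 1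
      module)
  have hB0 : B ⟨0, by omega⟩ = u := hB 0
  have hB1 : B ⟨1, by omega⟩ = v := hB 1
  have hfB : ∀ i : Fin n, f (B i) = if (i : ℕ) = 0 then 1 else 0 := by
    intro i
    split_ifs with h0
    · have : B i = u := hB0 ▸ congrArg B (Fin.ext h0)
      rw [this, hfu]
    · by_cases h1 : (i : ℕ) = 1
      · have : B i = v := hB1 ▸ congrArg B (Fin.ext h1)
        rw [this, hfv]
      · obtain ⟨y, hy⟩ := hB' i (by omega)
        simp [hy, hfu]
  refine mem_orbit_of_basis B fun i j m => ?_
  rw [hχf, ← hB1]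
  simp only [A3str, ofConst_single, hfB, map_smul, Module.Basis.repr_self, Finsupp.smul_apply,
    Finsupp.single_apply, smul_eq_mul, Fin.ext_iff]
  split_ifs <;> first | omega | simp

lemma levelIs_one_A3str [Infinite k] (hn : 2 ≤ n) {μ : AlgStr k n} (hμ : μ ∈ orbit (A3str n)) :
    levelIs μ 1 := by
  refine levelIs_one_of_closed (A3closure k n) (IsZariskiClosed.inter ?_ ?_)
    (orbit_A3str_subset hn) (fun χ => mem_orbit_A3str hn) ?_ hμ
  · exact isZariskiClosed_setOf fun t => .sub
      ((isStructPoly_apply _ _ _).mul (isStructPoly_apply _ _ _))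
      ((isStructPoly_apply _ _ _).mul (isStructPoly_apply _ _ _))
  · exact isZariskiClosed_setOf fun t => isStructPoly_apply_apply_left _ _ _ _
  · intro h
    have := congrFun (LinearMap.congr_fun (LinearMap.congr_fun h (Pi.single ⟨0, by omega⟩ 1))
      (Pi.single ⟨0, by omega⟩ 1)) ⟨1, by omega⟩
    simp [A3str, ofConst_single] at this

/-- Defining equations of the closure of the orbit of `n₃ ⊕ k^{n-3}`. -/
def n3closure (k : Type*) [Field k] (n : ℕ) : Set (AlgStr k n) :=
  {μ | ∀ t : (Fin n → k) × Fin n, μ t.1 t.1 t.2 = 0} ∩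
  {μ | ∀ t : ((Fin n → k) × (Fin n → k) × (Fin n → k) × (Fin n → k)) × Fin n × Fin n,
      μ t.1.1 t.1.2.1 t.2.1 * μ t.1.2.2.1 t.1.2.2.2 t.2.2 -
        μ t.1.1 t.1.2.1 t.2.2 * μ t.1.2.2.1 t.1.2.2.2 t.2.1 = 0} ∩
  {μ | ∀ t : ((Fin n → k) × (Fin n → k) × (Fin n → k) × (Fin n → k)) × Fin n,
      μ t.1.1 t.1.2.1 t.2 * μ t.1.2.2.1 t.1.2.2.2 t.2 -
        μ t.1.1 t.1.2.2.1 t.2 * μ t.1.2.1 t.1.2.2.2 t.2 +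
        μ t.1.1 t.1.2.2.2 t.2 * μ t.1.2.1 t.1.2.2.1 t.2 = 0} ∩
  {μ | ∀ t : ((Fin n → k) × (Fin n → k) × (Fin n → k)) × Fin n,
      μ t.1.1 (μ t.1.2.1 t.1.2.2) t.2 = 0}

lemma orbit_n3str_subset (hn : 3 ≤ n) : orbit (n3str n) ⊆ n3closure k n := by
  rintro _ ⟨g, rfl⟩
  refine ⟨⟨⟨?_, ?_⟩, ?_⟩, ?_⟩
  · rintro ⟨x, m⟩
    simp only [transport_apply, n3str_apply hn, map_smul, Pi.smul_apply, smul_eq_mul]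
    ring
  · rintro ⟨⟨x, y, z, w⟩, m, m'⟩
    simp only [transport_apply, n3str_apply hn, map_smul, Pi.smul_apply, smul_eq_mul]
    ring
  · rintro ⟨⟨x, y, z, w⟩, m⟩
    simp only [transport_apply, n3str_apply hn, map_smul, Pi.smul_apply, smul_eq_mul]
    ring
  · rintro ⟨⟨x, y, z⟩, m⟩
    simp [transport_apply, n3str_apply hn]

lemma mem_orbit_n3str (hn : 3 ≤ n) {χ : AlgStr k n} (h : χ ∈ n3closure k n) (hχ : χ ≠ 0) :
    χ ∈ orbit (n3str n) := by
  obtain ⟨⟨⟨halt, hmin⟩, hplu⟩, hnil⟩ := h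
  replace halt : ∀ x, χ x x = 0 := fun x => funext fun m => halt ⟨x, m⟩
  replace hmin : ∀ x y z w m m', χ x y m * χ z w m' = χ x y m' * χ z w m :=
    fun x y z w m m' => sub_eq_zero.mp (hmin ⟨⟨x, y, z, w⟩, m, m'⟩)
  replace hplu : ∀ x y z w m, χ x y m * χ z w m - χ x z m * χ y w m + χ x w m * χ y z m = 0 :=
    fun x y z w m => hplu ⟨⟨x, y, z, w⟩, m⟩
  replace hnil : ∀ x y z, χ x (χ y z) = 0 := fun x y z => funext fun m => hnil ⟨⟨x, y, z⟩, m⟩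
  obtain ⟨u, w, l, hs⟩ : ∃ u w l, χ u w l ≠ 0 := by
    by_contra! H
    exact hχ (LinearMap.ext fun p => LinearMap.ext fun q => funext fun l => H p q l)
  have hskew : χ w u = -χ u w := by
    have := halt (u + w)
    simp only [map_add, LinearMap.add_apply, halt, zero_add, add_zero] at this
    exact eq_neg_of_add_eq_zero_left this
  set v := χ u w with hv
  let F : Module.Dual k (Fin n → k) := (v l)⁻¹ • (LinearMap.proj l).comp (χ u)
  let G : Module.Dual k (Fin n → k) := (v l)⁻¹ • (LinearMap.proj l).comp (χ w)
  have hF : ∀ x, F x = (v l)⁻¹ * χ u x l := fun x => rfl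
  have hG : ∀ x, G x = (v l)⁻¹ * χ w x l := fun x => rfl
  have hχFG : ∀ x y, χ x y = (F x * G y - F y * G x) • v := by
    intro x y
    funext m
    have h1 := hmin x y u w m l
    have h2 := hplu u w x y l
    rw [← hv] at h1 h2
    simp only [hF, hG, Pi.smul_apply, smul_eq_mul]
    field_simp
    linear_combination (v l) * h1 + (v m) * h2
  have hFu : F u = 0 := by simp [hF, halt]
  have hFw : F w = 1 := by rw [hF, ← hv, inv_mul_cancel₀ hs]
  have hGu : G u = -1 := by rw [hG, hskew, Pi.neg_apply, mul_neg, inv_mul_cancel₀ hs]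
  have hGw : G w = 0 := by simp [hG, halt]
  have hFv : F v = 0 := by rw [hF, hv, hnil]; simp
  have hGv : G v = 0 := by rw [hG, hv, hnil]; simp
  have hv0 : v ≠ 0 := fun h0 => hs (by simp [h0])
  have hli : LinearIndependent k ![u, w, v] := by
    rw [Fintype.linearIndependent_iff]
    intro c hc
    simp only [Fin.sum_univ_three, Matrix.cons_val_zero, Matrix.cons_val_one,
      Matrix.cons_val] at hc
    have h1 : c 1 = 0 := by simpa [hFu, hFw, hFv] using congrArg F hc
    have h0 : c 0 = 0 := by simpa [hGu, hGw, hGv] using congrArg G hc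
    have h2 : c 2 = 0 := by simpa [h0, h1, hv0] using hc
    intro i
    fin_cases i <;> assumption
  obtain ⟨B, hB, hB'⟩ := exists_basis_extending_map hn hli
    (fun x => x - F x • w + G x • u)
    (fun x => by
      have h0 : u ∈ Submodule.span k (Set.range ![u, w, v]) := Submodule.subset_span ⟨0, rfl⟩
      have h1 : w ∈ Submodule.span k (Set.range ![u, w, v]) := Submodule.subset_span ⟨1, rfl⟩
      convert sub_mem (Submodule.smul_mem _ (G x) h0) (Submodule.smul_mem _ (F x) h1) using 1
      module)
  have hB0 : B ⟨0, by omega⟩ = u := hB 0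
  have hB1 : B ⟨1, by omega⟩ = w := hB 1
  have hB2 : B ⟨2, by omega⟩ = v := hB 2
  have hFGB : ∀ i : Fin n, F (B i) = (if (i : ℕ) = 1 then 1 else 0) ∧
      G (B i) = if (i : ℕ) = 0 then -1 else 0 := by
    intro i
    by_cases h0 : (i : ℕ) = 0
    · have : B i = u := hB0 ▸ congrArg B (Fin.ext h0)
      simp [this, hFu, hGu, h0]
    by_cases h1 : (i : ℕ) = 1
    · have : B i = w := hB1 ▸ congrArg B (Fin.ext h1)
      simp [this, hFw, hGw, h1]
    by_cases h2 : (i : ℕ) = 2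
    · have : B i = v := hB2 ▸ congrArg B (Fin.ext h2)
      simp [this, hFv, hGv, h2]
    · obtain ⟨y, hy⟩ := hB' i (by omega)
      simp [hy, hFu, hFw, hGu, hGw, h0, h1]
  refine mem_orbit_of_basis B fun i j m => ?_
  rw [hχFG, ← hB2]
  simp only [n3str, ofConst_single, (hFGB _).1, (hFGB _).2, map_smul, Module.Basis.repr_self,
    Finsupp.smul_apply, Finsupp.single_apply, smul_eq_mul, Fin.ext_iff]
  split_ifs <;> first | omega | simp

lemma levelIs_one_n3str [Infinite k] (hn : 3 ≤ n) {μ : AlgStr k n} (hμ : μ ∈ orbit (n3str n)) :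
    levelIs μ 1 := by
  refine levelIs_one_of_closed (n3closure k n)
    (((IsZariskiClosed.inter ?_ ?_).inter ?_).inter ?_)
    (orbit_n3str_subset hn) (fun χ => mem_orbit_n3str hn) ?_ hμ
  · exact isZariskiClosed_setOf fun t => isStructPoly_apply _ _ _
  · exact isZariskiClosed_setOf fun t => .sub
      ((isStructPoly_apply _ _ _).mul (isStructPoly_apply _ _ _))
      ((isStructPoly_apply _ _ _).mul (isStructPoly_apply _ _ _))
  · exact isZariskiClosed_setOf fun t => .add
      (.sub ((isStructPoly_apply _ _ _).mul (isStructPoly_apply _ _ _))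
      ((isStructPoly_apply _ _ _).mul (isStructPoly_apply _ _ _)))
      ((isStructPoly_apply _ _ _).mul (isStructPoly_apply _ _ _))
  · exact isZariskiClosed_setOf fun t => isStructPoly_apply_apply _ _ _ _
  · intro h
    have := congrFun (LinearMap.congr_fun (LinearMap.congr_fun h (Pi.single ⟨0, by omega⟩ 1))
      (Pi.single ⟨1, by omega⟩ 1)) ⟨2, by omega⟩
    simp [n3str, ofConst_single] at this

end ClosedOrbits

section DegenerationsToLevelOne

variable {n : ℕ}

lemma mem_span_basis_iff (b : Module.Basis (Fin n) k (Fin n → k)) (s : Set (Fin n))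
    (x : Fin n → k) : x ∈ Submodule.span k (b '' s) ↔ ∀ m ∉ s, b.repr x m = 0 := by
  rw [b.mem_span_image, Set.subset_def]
  refine forall_congr' fun m => ?_
  rw [Finset.mem_coe, Finsupp.mem_support_iff]
  tauto

lemma degenerates_A3str [Infinite k] (hn : 2 ≤ n) {μ : AlgStr k n} {x : Fin n → k}
    (hx : μ x x ∉ Submodule.span k {x}) : degenerates μ (A3str n) := by
  have hx0 : x ≠ 0 := by rintro rfl; simp at hx
  have hli : LinearIndependent k ![x, μ x x] := by
    rw [LinearIndependent.pair_iff' hx0]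
    exact fun a ha => hx (Submodule.mem_span_singleton.2 ⟨a, ha⟩)
  obtain ⟨B, hB⟩ := exists_basis_extending hn hli
  have hB0 : B ⟨0, by omega⟩ = x := hB 0
  have hB1 : B ⟨1, by omega⟩ = μ x x := hB 1
  convert degenerates_of_weights μ B (fun i => if (i : ℕ) = 0 then 1 else 2)
    (fun i j m h => by split_ifs at h <;> omega) using 1
  refine algStr_ext fun i j m => ?_
  simp only [A3str, ofConst_single]
  by_cases hij : (i : ℕ) = 0 ∧ (j : ℕ) = 0
  · have hi : B i = x := hB0 ▸ congrArg B (Fin.ext hij.1)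
    have hj : B j = x := hB0 ▸ congrArg B (Fin.ext hij.2)
    rw [hi, hj, ← hB1, Module.Basis.repr_self, Finsupp.single_apply]
    simp only [Fin.ext_iff]
    split_ifs <;> first | omega | rfl
  · rw [if_neg (by tauto), if_neg]
    split_ifs <;> omega

lemma degenerates_n3str [Infinite k] {μ : AlgStr k n}
    (hsq : ∀ x, μ x x ∈ Submodule.span k {x}) {x y : Fin n → k}
    (hxy : μ x y ∉ Submodule.span k {x, y}) : 3 ≤ n ∧ degenerates μ (n3str n) := by
  have hx0 : x ≠ 0 := by rintro rfl; simp at hxy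
  have hli2 : LinearIndependent k ![x, y] := by
    rw [LinearIndependent.pair_iff' hx0]
    rintro a rfl
    refine hxy ?_
    rw [map_smul]
    exact Submodule.smul_mem _ _ (Submodule.span_mono (by simp) (hsq x))
  have hli : LinearIndependent k ![x, y, μ x y] := by
    have h : ![x, y, μ x y] = Fin.snoc (α := fun _ => Fin n → k) ![x, y] (μ x y) := by
      funext i
      fin_cases i <;> rfl
    rw [h]
    exact linearIndependent_finSnoc.2 ⟨hli2, by simpa [Set.pair_comm] using hxy⟩
  have hn : 3 ≤ n := by simpa using hli.fintype_card_le_finrank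
  refine ⟨hn, ?_⟩
  obtain ⟨B, hB⟩ := exists_basis_extending hn hli
  have hB0 : B ⟨0, by omega⟩ = x := hB 0
  have hB1 : B ⟨1, by omega⟩ = y := hB 1
  have hB2 : B ⟨2, by omega⟩ = μ x y := hB 2
  convert degenerates_of_weights μ B (fun i => if (i : ℕ) < 2 then 1 else 2)
    (fun i j m h => by split_ifs at h <;> omega) using 1
  refine algStr_ext fun i j m => ?_
  have hsqB : ∀ i m, i ≠ m → B.repr (μ (B i) (B i)) m = 0 := fun i m him =>
    (mem_span_basis_iff B {i} _).1 (by simpa using hsq (B i)) m (by simpa using him.symm)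
  simp only [n3str, ofConst_single]
  by_cases hw : (i : ℕ) < 2 ∧ (j : ℕ) < 2 ∧ 2 ≤ (m : ℕ)
  · rw [if_pos (c := (_ : ℕ) = _) (by split_ifs <;> omega)]
    by_cases hij : i = j
    · subst hij
      rw [hsqB i m (by rw [ne_eq, Fin.ext_iff]; omega), if_neg (by omega), if_neg (by omega)]
    · have hij' : (i : ℕ) ≠ j := fun h => hij (Fin.ext h)
      by_cases hi : (i : ℕ) = 0
      · have hBi : B i = x := hB0 ▸ congrArg B (Fin.ext hi)
        have hBj : B j = y := hB1 ▸ congrArg B (Fin.ext (show (j : ℕ) = 1 by omega))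
        rw [hBi, hBj, ← hB2, Module.Basis.repr_self, Finsupp.single_apply]
        simp only [Fin.ext_iff]
        split_ifs <;> first | omega | rfl
      · have hBi : B i = y := hB1 ▸ congrArg B (Fin.ext (show (i : ℕ) = 1 by omega))
        have hBj : B j = x := hB0 ▸ congrArg B (Fin.ext (show (j : ℕ) = 0 by omega))
        have hskew : B.repr (μ y x) m = -B.repr (μ x y) m := by
          have h := (mem_span_basis_iff B {i, j} (μ (x + y) (x + y))).1 (by
            refine (Submodule.span_le.2 ?_) (hsq (x + y))
            rw [Set.singleton_subset_iff, ← hBi, ← hBj]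
            exact add_mem (Submodule.subset_span ⟨j, by simp, rfl⟩)
              (Submodule.subset_span ⟨i, by simp, rfl⟩)) m
            (by simp only [Set.mem_insert_iff, Set.mem_singleton_iff, Fin.ext_iff]; omega)
          have hx := hsqB j m (by rw [ne_eq, Fin.ext_iff]; omega)
          have hy := hsqB i m (by rw [ne_eq, Fin.ext_iff]; omega)
          rw [hBj] at hx
          rw [hBi] at hy
          simp only [map_add, LinearMap.add_apply, Finsupp.add_apply, hx, hy] at h
          linear_combination h
        rw [hBi, hBj, hskew, ← hB2, Module.Basis.repr_self, Finsupp.single_apply]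
        simp only [Fin.ext_iff]
        split_ifs <;> first | omega | simp
  · rw [if_neg (by omega), if_neg (by omega), if_neg]
    split_ifs <;> omega

/-- If every pair of vectors spans a subalgebra, then contracting along a line gives a structure
determined by a linear form and two scalars. -/
lemma degenerates_formStr [Infinite k] (hn : 2 ≤ n) {μ : AlgStr k n}
    (hsq : ∀ x, μ x x ∈ Submodule.span k {x})
    (hmul : ∀ x y, μ x y ∈ Submodule.span k {x, y}) {x : Fin n → k} (hx : x ≠ 0) :
    ∃ a b : k, degenerates μ (formStr n a b (LinearMap.proj ⟨0, by omega⟩)) ∧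
      (a = 0 → b = 0 → μ x x = 0 ∧ ∀ y, μ x y ∈ Submodule.span k {x} ∧
        μ y x ∈ Submodule.span k {x}) := by
  have h0n : 0 < n := by omega
  set z : Fin n := ⟨0, h0n⟩ with hz
  set o : Fin n := ⟨1, hn⟩ with ho
  obtain ⟨B, hB⟩ := exists_basis_extending (r := 1) (v := ![x]) (by omega)
    (LinearIndependent.of_subsingleton 0 hx)
  have hBz : B z = x := hB 0
  have hoz : o ≠ z := by simp [ho, hz]
  have hself : ∀ i m, m ≠ i → B.repr (μ (B i) (B i)) m = 0 := fun i m him =>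
    (mem_span_basis_iff B {i} _).1 (by simpa using hsq (B i)) m (by simpa using him)
  have hpair : ∀ i j m, m ≠ i → m ≠ j → B.repr (μ (B i) (B j)) m = 0 := fun i j m hi hj =>
    (mem_span_basis_iff B {i, j} _).1 (by simpa [Set.image_pair] using hmul (B i) (B j)) m
      (by simp [hi, hj])
  have hleft : ∀ j, j ≠ z → B.repr (μ (B z) (B j)) j = B.repr (μ (B z) (B o)) o := by
    intro j hj
    rcases eq_or_ne j o with rfl | hjo
    · rfl
    obtain ⟨s, t, hst⟩ := Submodule.mem_span_pair.1 (hmul (B z) (B j + B o))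
    have h1 := congrArg (fun v => B.repr v j) hst
    have h2 := congrArg (fun v => B.repr v o) hst
    simp only [map_add, map_smul, Finsupp.add_apply, Finsupp.smul_apply, Module.Basis.repr_self,
      Finsupp.single_apply, smul_eq_mul, hj.symm, hoz.symm, hjo, hjo.symm, if_true, if_false]
      at h1 h2
    have h3 := hpair z o j hj hjo
    have h4 := hpair z j o hoz hjo.symm
    linear_combination h2 - h1 - h3 + h4
  have hright : ∀ j, j ≠ z → B.repr (μ (B j) (B z)) j = B.repr (μ (B o) (B z)) o := by
    intro j hj
    rcases eq_or_ne j o with rfl | hjo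
    · rfl
    obtain ⟨s, t, hst⟩ := Submodule.mem_span_pair.1 (hmul (B j + B o) (B z))
    have h1 := congrArg (fun v => B.repr v j) hst
    have h2 := congrArg (fun v => B.repr v o) hst
    simp only [map_add, map_smul, Finsupp.add_apply, Finsupp.smul_apply, Module.Basis.repr_self,
      Finsupp.single_apply, smul_eq_mul, hj.symm, hoz.symm, hjo, hjo.symm, if_true, if_false,
      LinearMap.add_apply] at h1 h2
    have h3 := hpair o z j hjo hj
    have h4 := hpair j z o hjo.symm hoz
    linear_combination h2 - h1 - h3 + h4
  have hsum : B.repr (μ (B z) (B z)) z = B.repr (μ (B z) (B o)) o + B.repr (μ (B o) (B z)) o := by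
    have key : ∀ s : k, s ≠ 0 → B.repr (μ (B z) (B z)) z +
        s * (B.repr (μ (B z) (B o)) z + B.repr (μ (B o) (B z)) z) =
        B.repr (μ (B z) (B o)) o + B.repr (μ (B o) (B z)) o + s * B.repr (μ (B o) (B o)) o := by
      intro s hs
      obtain ⟨t, ht⟩ := Submodule.mem_span_singleton.1 (hsq (B z + s • B o))
      have h1 := congrArg (fun v => B.repr v z) ht
      have h2 := congrArg (fun v => B.repr v o) ht
      simp only [map_add, map_smul, Finsupp.add_apply, Finsupp.smul_apply, Module.Basis.repr_self,
        Finsupp.single_apply, smul_eq_mul, hoz, hoz.symm, if_true, if_false,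
        LinearMap.add_apply, LinearMap.smul_apply] at h1 h2
      have h3 := hself o z hoz.symm
      have h4 := hself z o hoz
      refine mul_left_cancel₀ hs ?_
      linear_combination h2 - s * h1 - s ^ 3 * h3 + h4
    classical
    obtain ⟨s, hs⟩ := Infinite.exists_notMem_finset ({0, 1} : Finset k)
    simp only [Finset.mem_insert, Finset.mem_singleton, not_or] at hs
    have h1 := key 1 one_ne_zero
    have h2 := key s hs.1
    refine mul_left_cancel₀ (sub_ne_zero.2 hs.2) ?_
    linear_combination s * h1 - h2
  have key : formStr n (B.repr (μ (B z) (B o)) o) (B.repr (μ (B o) (B z)) o) (LinearMap.proj z) =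
      ofConst fun i j m => if (if i = z then 0 else 1) + (if j = z then 0 else 1) =
        (if m = z then 0 else 1) then B.repr (μ (B i) (B j)) m else 0 := by
    refine algStr_ext fun i j m => ?_
    simp only [ofConst_single, formStr_apply, LinearMap.proj_apply, Pi.add_apply,
      Pi.smul_apply, Pi.single_apply, smul_eq_mul, eq_comm (a := z)]
    by_cases hi : i = z <;> by_cases hj : j = z <;> by_cases hm : m = z
    · simp [hi, hj, hm, hsum]
    · simp [hi, hj, hm]
    · subst hi hm
      simp [hj, Ne.symm hj]
    · subst hi
      by_cases hmj : m = j
      · subst hmj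
        simp [hm, hleft m hm]
      · simp [hj, hm, hmj, hpair z j m hm hmj]
    · subst hj hm
      simp [hi, Ne.symm hi]
    · subst hj
      by_cases hmi : m = i
      · subst hmi
        simp [hm, hright m hm]
      · simp [hi, hm, hmi, hpair i z m hmi hm]
    · simp [hi, hj, hm]
    · simp [hi, hj, hm]
  refine ⟨B.repr (μ (B z) (B o)) o, B.repr (μ (B o) (B z)) o, ?_,
    fun ha hb => ⟨?_, fun y => ⟨?_, ?_⟩⟩⟩
  · rw [key]
    refine degenerates_of_weights μ B (fun i => if i = z then 0 else 1) fun i j m h => ?_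
    split_ifs at h with hi hj hm
    all_goals try omega
    subst hi hj
    exact hself _ m hm
  · rw [← hBz]
    refine B.ext_elem fun m => ?_
    rw [map_zero, Finsupp.zero_apply]
    rcases eq_or_ne m z with rfl | hm
    · rw [hsum, ha, hb, add_zero]
    · exact hself z m hm
  · have h : ⊤ ≤ (Submodule.span k {x}).comap (μ x) := by
      rw [← B.span_eq, Submodule.span_le]
      rintro _ ⟨j, rfl⟩
      rw [SetLike.mem_coe, Submodule.mem_comap, ← hBz, ← Set.image_singleton, mem_span_basis_iff]
      intro m hm
      rw [Set.mem_singleton_iff] at hm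
      rcases eq_or_ne m j with rfl | hmj
      · exact (hleft m hm).trans ha
      · exact hpair z j m hm hmj
    exact h (Submodule.mem_top (x := y))
  · have h : ⊤ ≤ (Submodule.span k {x}).comap (μ.flip x) := by
      rw [← B.span_eq, Submodule.span_le]
      rintro _ ⟨j, rfl⟩
      rw [SetLike.mem_coe, Submodule.mem_comap, ← hBz, ← Set.image_singleton, mem_span_basis_iff]
      intro m hm
      rw [Set.mem_singleton_iff] at hm
      rcases eq_or_ne m j with rfl | hmj
      · exact (hright m hm).trans hb
      · exact hpair j z m hmj hm
    exact h (Submodule.mem_top (x := y))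

lemma eq_zero_of_mul_mem_span {μ : AlgStr k n}
    (h : ∀ x, x ≠ 0 → μ x x = 0 ∧ ∀ y, μ x y ∈ Submodule.span k {x} ∧
      μ y x ∈ Submodule.span k {x}) : μ = 0 := by
  refine LinearMap.ext fun x => LinearMap.ext fun y => ?_
  rw [LinearMap.zero_apply, LinearMap.zero_apply]
  rcases eq_or_ne x 0 with rfl | hx
  · simp
  rcases eq_or_ne y 0 with rfl | hy
  · simp
  obtain ⟨s, hs⟩ := Submodule.mem_span_singleton.1 ((h x hx).2 y).1
  obtain ⟨t, ht⟩ := Submodule.mem_span_singleton.1 ((h y hy).2 x).2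
  rw [← hs]
  rcases eq_or_ne s 0 with rfl | hs0
  · simp
  have hxy : x = (s⁻¹ * t) • y := by
    rw [mul_smul, ht, ← hs, smul_smul, inv_mul_cancel₀ hs0, one_smul]
  rw [hs, hxy, map_smul, LinearMap.smul_apply, (h y hy).1, smul_zero]

end DegenerationsToLevelOne

/-! ## STATEMENT 8 -/
theorem stmt8 {k : Type*} [Field k] [IsAlgClosed k] (n : ℕ) (hn : 2 ≤ n) :
    (∀ μ : AlgStr k n, levelIs μ 1 ↔
      (μ ∈ orbit (A3str n) ∨ (3 ≤ n ∧ μ ∈ orbit (n3str n)) ∨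
        μ ∈ orbit (pminusStr n) ∨ ∃ α : k, μ ∈ orbit (nuStr n α))) ∧
    (3 ≤ n → orbit (A3str (k := k) n) ≠ orbit (n3str n)) ∧
    orbit (A3str (k := k) n) ≠ orbit (pminusStr n) ∧
    (3 ≤ n → orbit (n3str (k := k) n) ≠ orbit (pminusStr n)) ∧
    (∀ α : k, orbit (A3str n) ≠ orbit (nuStr n α) ∧
      (3 ≤ n → orbit (n3str (k := k) n) ≠ orbit (nuStr n α)) ∧
      orbit (pminusStr (k := k) n) ≠ orbit (nuStr n α)) ∧
    (∀ α β : k, α ≠ β → orbit (nuStr n α) ≠ orbit (nuStr n β)) := by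
  have h0 : 0 < n := by omega
  have hproj : (LinearMap.proj ⟨0, h0⟩ : Module.Dual k (Fin n → k)) ≠ 0 := fun h => by
    simpa using LinearMap.congr_fun h (Pi.single ⟨0, h0⟩ 1)
  let e (i : ℕ) (hi : i < n) : Fin n → k := Pi.single ⟨i, hi⟩ 1
  have hA3 : ∀ (a b : k) f, A3str n ≠ formStr n a b f := by
    intro a b f h
    have := congrFun (LinearMap.congr_fun (LinearMap.congr_fun h (e 0 h0)) (e 0 h0)) ⟨1, hn⟩
    simp [A3str, ofConst_single, formStr_apply, e] at this
  have hn3 : 3 ≤ n → ∀ (a b : k) f, n3str n ≠ formStr n a b f := by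
    intro hn' a b f h
    have := congrFun (LinearMap.congr_fun (LinearMap.congr_fun h (e 0 h0)) (e 1 hn)) ⟨2, hn'⟩
    simp [n3str, ofConst_single, formStr_apply, e] at this
  have hnu : ∀ (a b α : k) f, nuStr n α = formStr n a b f →
      (a + b) * f (e 0 h0) = 1 ∧ a * f (e 0 h0) = α := by
    intro a b α f h
    have h1 := congrFun (LinearMap.congr_fun (LinearMap.congr_fun h (e 0 h0)) (e 0 h0)) ⟨0, h0⟩
    have h2 := congrFun (LinearMap.congr_fun (LinearMap.congr_fun h (e 0 h0)) (e 1 hn)) ⟨1, hn⟩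
    simp [nuStr, ofConst_single, formStr_apply, e] at h1 h2
    exact ⟨by rw [add_mul]; exact h1.symm, h2.symm⟩
  have hnonzero : ∀ (a b : k), a ≠ 0 ∨ b ≠ 0 → formStr n a b (LinearMap.proj ⟨0, h0⟩) ≠ 0 := by
    intro a b hab h
    have h2 := congrFun (LinearMap.congr_fun (LinearMap.congr_fun h (e 0 h0)) (e 1 hn)) ⟨1, hn⟩
    have h3 := congrFun (LinearMap.congr_fun (LinearMap.congr_fun h (e 1 hn)) (e 0 h0)) ⟨1, hn⟩
    simp [formStr_apply, e] at h2 h3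
    tauto
  refine ⟨fun μ => ⟨fun hμ => ?_, ?_⟩, ?_, ?_, ?_, ?_, ?_⟩
  · have hμ0 := ne_zero_of_levelIs_one hμ
    by_cases hsq : ∀ x, μ x x ∈ Submodule.span k {x}
    · by_cases hmul : ∀ x y, μ x y ∈ Submodule.span k {x, y}
      · right; right
        obtain ⟨x, hx, hne⟩ : ∃ x, x ≠ 0 ∧ ¬ (μ x x = 0 ∧ ∀ y, μ x y ∈ Submodule.span k {x} ∧
            μ y x ∈ Submodule.span k {x}) := by
          by_contra! H
          exact hμ0 (eq_zero_of_mul_mem_span fun x hx => H x hx)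
        obtain ⟨a, b, hdeg, hab⟩ := degenerates_formStr hn hsq hmul hx
        have hab' : a ≠ 0 ∨ b ≠ 0 := by
          by_contra! H
          exact hne (hab H.1 H.2)
        have hmem := mem_orbit_of_levelIs_one hμ hdeg (hnonzero a b hab')
        exact (formStr_mem_orbit_pminus_or_nu h0 hab' hproj).imp
          (fun h => mem_orbit_trans h hmem) fun ⟨α, h⟩ => ⟨α, mem_orbit_trans h hmem⟩
      · right; left
        push Not at hmul
        obtain ⟨x, y, hxy⟩ := hmul
        obtain ⟨hn', hdeg⟩ := degenerates_n3str hsq hxy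
        exact ⟨hn', mem_orbit_of_levelIs_one hμ hdeg
          ((hn3 hn' 0 0 0).trans_eq (map_zero _))⟩
    · left
      push Not at hsq
      obtain ⟨x, hx⟩ := hsq
      exact mem_orbit_of_levelIs_one hμ (degenerates_A3str hn hx)
        ((hA3 0 0 0).trans_eq (map_zero _))
  · rintro (h | ⟨hn', h⟩ | h | ⟨α, h⟩)
    · exact levelIs_one_A3str hn h
    · exact levelIs_one_n3str hn' h
    · rw [pminusStr_eq h0] at h
      exact levelIs_one_formStr h0 (hnonzero _ _ (.inl one_ne_zero)) h
    · rw [nuStr_eq h0] at h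
      refine levelIs_one_formStr h0 (hnonzero _ _ ?_) h
      by_contra! H
      simp [H.1] at H
  · intro hn' h
    have hmem : A3str n ∈ orbit (n3str (k := k) n) := h ▸ mem_orbit_self _
    have := (orbit_n3str_subset hn' hmem).1.1.1 ⟨e 0 h0, ⟨1, hn⟩⟩
    simp [A3str, ofConst_single, e] at this
  · intro h
    have hmem : A3str n ∈ orbit (pminusStr (k := k) n) := h ▸ mem_orbit_self _
    rw [pminusStr_eq h0] at hmem
    obtain ⟨f, hf⟩ := exists_formStr_of_mem_orbit hmem
    exact hA3 _ _ f hf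
  · intro hn' h
    have hmem : n3str n ∈ orbit (pminusStr (k := k) n) := h ▸ mem_orbit_self _
    rw [pminusStr_eq h0] at hmem
    obtain ⟨f, hf⟩ := exists_formStr_of_mem_orbit hmem
    exact hn3 hn' _ _ f hf
  · refine fun α => ⟨fun h => ?_, fun hn' h => ?_, fun h => ?_⟩
    · have hmem : A3str n ∈ orbit (nuStr n α) := h ▸ mem_orbit_self _
      rw [nuStr_eq h0] at hmem
      obtain ⟨f, hf⟩ := exists_formStr_of_mem_orbit hmem
      exact hA3 _ _ f hf
    · have hmem : n3str n ∈ orbit (nuStr n α) := h ▸ mem_orbit_self _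
      rw [nuStr_eq h0] at hmem
      obtain ⟨f, hf⟩ := exists_formStr_of_mem_orbit hmem
      exact hn3 hn' _ _ f hf
    · have hmem : nuStr n α ∈ orbit (pminusStr n) := h ▸ mem_orbit_self _
      rw [pminusStr_eq h0] at hmem
      obtain ⟨f, hf⟩ := exists_formStr_of_mem_orbit hmem
      simpa using (hnu _ _ _ f hf).1
  · intro α β hαβ h
    have hmem : nuStr n α ∈ orbit (nuStr n β) := h ▸ mem_orbit_self _
    rw [nuStr_eq h0 β] at hmem
    obtain ⟨f, hf⟩ := exists_formStr_of_mem_orbit hmem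
    obtain ⟨h1, h2⟩ := hnu _ _ _ f hf
    rw [add_sub_cancel, one_mul] at h1
    rw [h1, mul_one] at h2
    exact hαβ h2.symm

end
end

section
/- Let A be an n-dimensional algebra with G(A) = 1. Then A has an (n−1)-dimensional linear subspace U such that a·a = 0 for all a ∈ U. -/
open scoped BigOperators

noncomputable section

variable {k : Type*} [Field k]

/-- Over an infinite field, a bilinear multiplication in which every vector
squares to a multiple of itself has square `a * a = f a • a` for some linear functional `f`. -/
theorem exists_linear_square_coeff {k V : Type*} [Field k] [Infinite k] [AddCommGroup V]
    [Module k V] (μ : V →ₗ[k] V →ₗ[k] V) (hμ : ∀ a, ∃ c : k, μ a a = c • a) :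
    ∃ f : V →ₗ[k] k, ∀ a, μ a a = f a • a := by
  have hμ' : ∀ a, ∃ c : k, μ a a = c • a ∧ (a = 0 → c = 0) := by
    intro a
    by_cases ha : a = 0
    · exact ⟨0, by simp [ha], fun _ => rfl⟩
    · obtain ⟨c, hc⟩ := hμ a
      exact ⟨c, hc, fun h => absurd h ha⟩
  choose f hf hf0 using hμ'
  have smul_f : ∀ (t : k) a, f (t • a) = t * f a := by
    intro t a
    by_cases ha : a = 0
    · simp [ha, hf0 0 rfl]
    by_cases ht : t = 0
    · simp [ht, hf0 0 rfl]
    have h := hf (t • a)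
    simp only [map_smul, LinearMap.smul_apply, hf a, smul_smul] at h
    have h' := smul_left_injective k ha h
    apply mul_left_cancel₀ ht
    linear_combination -h'
  have add_f : ∀ a b, f (a + b) = f a + f b := by
    intro a b
    by_cases ha : a = 0
    · simp [ha, hf0 0 rfl]
    by_cases hab : ∃ t : k, t • a = b
    · obtain ⟨t, rfl⟩ := hab
      have : a + t • a = (1 + t) • a := by module
      rw [this, smul_f, smul_f]
      ring
    have hli : LinearIndependent k ![a, b] :=
      (LinearIndependent.pair_iff' ha).2 fun t ht => hab ⟨t, ht⟩
    have key : ∀ t : k, t • (μ a b + μ b a) =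
        (f (a + t • b) - f a) • a + (f (a + t • b) * t - t * t * f b) • b := by
      intro t
      have h := hf (a + t • b)
      simp only [map_add, map_smul, LinearMap.add_apply, LinearMap.smul_apply, hf a, hf b] at h
      linear_combination (norm := module) h
    have key₁ := key 1
    simp only [one_smul, mul_one, one_mul] at key₁
    have cmp : ∀ t : k, f (a + t • b) - f a = t * (f (a + b) - f a) ∧
        f (a + t • b) * t - t * t * f b = t * (f (a + b) - f b) := by
      intro t
      have h := key t
      rw [key₁, smul_add, smul_smul, smul_smul] at h
      exact (LinearIndependent.eq_of_pair hli h).imp Eq.symm Eq.symm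
    classical
    obtain ⟨t, ht⟩ := Infinite.exists_notMem_finset ({0, 1} : Finset k)
    simp only [Finset.mem_insert, Finset.mem_singleton, not_or] at ht
    obtain ⟨h₁, h₂⟩ := cmp t
    have : t * (t - 1) * (f (a + b) - (f a + f b)) = 0 := by
      linear_combination h₂ - t * h₁
    rcases mul_eq_zero.1 this with h | h
    · exact absurd h (mul_ne_zero ht.1 (sub_ne_zero.2 ht.2))
    · exact sub_eq_zero.1 h
  exact ⟨{ toFun := f, map_add' := add_f, map_smul' := by simpa using smul_f }, hf⟩

/-- In an algebra of generation type `1` every element squares to a multiple of itself. -/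
theorem exists_square_eq_smul_of_genType_one {k : Type*} [Field k] {n : ℕ} {μ : AlgStr k n}
    (h : genType μ 1) (a : Fin n → k) : ∃ c : k, μ a a = c • a := by
  by_cases ha : a = 0
  · exact ⟨0, by simp [ha]⟩
  have hmem : a ∈ subalgGen μ {a} :=
    Submodule.mem_sInf.2 fun W hW => hW.1 rfl
  have hsq : μ a a ∈ subalgGen μ {a} :=
    Submodule.mem_sInf.2 fun W hW => hW.2 a (hW.1 rfl) a (hW.1 rfl)
  obtain ⟨v, hv⟩ := finrank_le_one_iff.1 (h.2 ⟨a, rfl⟩)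
  obtain ⟨s, hs⟩ := hv ⟨a, hmem⟩
  obtain ⟨t, ht⟩ := hv ⟨μ a a, hsq⟩
  have hs' : s • (v : Fin n → k) = a := congrArg Subtype.val hs
  have ht' : t • (v : Fin n → k) = μ a a := congrArg Subtype.val ht
  have hs0 : s ≠ 0 := by
    rintro rfl
    exact ha (by rw [← hs', zero_smul])
  refine ⟨t * s⁻¹, ?_⟩
  calc μ a a = t • (v : Fin n → k) := ht'.symm
    _ = (t * s⁻¹) • s • (v : Fin n → k) := by rw [smul_smul, mul_assoc, inv_mul_cancel₀ hs0, mul_one]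
    _ = (t * s⁻¹) • a := by rw [hs']

/-! ## STATEMENT 9 -/
theorem stmt9 {k : Type*} [Field k] [IsAlgClosed k] (n : ℕ) (μ : AlgStr k n)
    (h : genType μ 1) :
    ∃ U : Submodule k (Fin n → k), Module.finrank k ↥U = n - 1 ∧
      ∀ a ∈ U, μ a a = 0 := by
  have : Infinite k := IsAlgClosed.instInfinite
  obtain ⟨f, hf⟩ := exists_linear_square_coeff μ (exists_square_eq_smul_of_genType_one h)
  obtain rfl | hn := Nat.eq_zero_or_pos n
  · exact ⟨⊥, by simp, fun a _ => Subsingleton.elim _ _⟩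
  obtain ⟨g, hg, hgf⟩ : ∃ g : Module.Dual k (Fin n → k), g ≠ 0 ∧ ∀ a, g a = 0 → f a = 0 := by
    by_cases hf0 : f = 0
    · refine ⟨LinearMap.proj ⟨0, hn⟩, fun h0 => ?_, fun a _ => by simp [hf0]⟩
      simpa using LinearMap.congr_fun h0 (fun _ => 1)
    · exact ⟨f, hf0, fun a ha => ha⟩
  refine ⟨LinearMap.ker g, ?_, fun a ha => by rw [hf, hgf a ha, zero_smul]⟩
  have := Module.Dual.finrank_ker_add_one_of_ne_zero hg
  rw [Module.finrank_fin_fun] at this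
  omega

end
end
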